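/- Let g be a simplicial Lie algebra over a field of characteristic 0. The degenerate subspace D_n = Σ_{i} σ_i(g_{n−1}) ⊆ g_n is an ideal for the Eilenberg–Zilber shuffle bracket; consequently the shuffle bracket descends to the quotient complex g_n/D_n, making the (un-normalized quotient model of the) normalized chain complex N(g) into a chain Lie algebra. -/

import Mathlib

open Finset

section SimplicialLie

variable {k : Type} [Field k] [CharZero k]
variable {g : ℕ → Type} [∀ n, LieRing (g n)] [∀ n, LieAlgebra k (g n)]

/-- Iterated application of degeneracy operators `σ_{l_r} ⋯ σ_{l_1}` (the first entry of the
list is applied first). -/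
def iterDeg (σop : ∀ n, ℕ → g n →ₗ⁅k⁆ g (n + 1)) :
    ∀ (l : List ℕ) (m : ℕ), g m → g (m + l.length)
  | [], _, x => x
  | i :: l, m, x =>
      cast (congrArg g (by simp only [List.length_cons]; omega))
        (iterDeg σop l (m + 1) (σop m i x))

/-- Iterated degeneracies, recast to land in a specified level. -/
def iterDegTo (σop : ∀ n, ℕ → g n →ₗ⁅k⁆ g (n + 1))
    (l : List ℕ) (m M : ℕ) (h : m + l.length = M) (x : g m) : g M :=
  cast (congrArg g h) (iterDeg σop l m x)

/-- The Eilenberg–Zilber shuffle bracket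
`⟦a,b⟧ = Σ_{(μ,ν) ∈ Sh(p,q)} (−1)^{(μ,ν)} ⁅σ_{ν_q}⋯σ_{ν_1} a, σ_{μ_p}⋯σ_{μ_1} b⁆`
of `a ∈ g_p` and `b ∈ g_q`, landing in `g_{p+q}`.  A `(p,q)`-shuffle is encoded by the set
`S ⊆ {0,…,p+q−1}` of cardinality `q` of values of `ν`; the complement gives the values of
`μ`, and `(−1)^{(μ,ν)}` is the sign of the associated shuffle permutation, which equals
`(−1)^{Σ_{x∈S} x + pq + q(q−1)/2}`. -/
noncomputable def shuffleBracket (σop : ∀ n, ℕ → g n →ₗ⁅k⁆ g (n + 1))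
    (p q : ℕ) (a : g p) (b : g q) : g (p + q) :=
  ∑ S : {S : Finset (Fin (p + q)) // S.card = q},
    ((-1 : k) ^ ((∑ x ∈ S.1, (x : ℕ)) + p * q + q * (q - 1) / 2)) •
      ⁅iterDegTo σop ((S.1.sort (· ≤ ·)).map Fin.val) p (p + q)
          (by simp [Finset.length_sort, S.2]) a,
        iterDegTo σop (((S.1ᶜ).sort (· ≤ ·)).map Fin.val) q (p + q)
          (by simp [Finset.length_sort, Finset.card_compl, S.2]; omega) b⁆

/-- The degenerate subspace `D_n = Σ_i σ_i(g_{n−1}) ⊆ g_n`. -/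
noncomputable def degenerateSubspace (σop : ∀ n, ℕ → g n →ₗ⁅k⁆ g (n + 1)) :
    ∀ n, Submodule k (g n)
  | 0 => ⊥
  | n + 1 => ⨆ i : Fin (n + 1), LinearMap.range (σop n (i : ℕ)).toLinearMap

end SimplicialLie

section Gen

variable {k : Type} [Field k]
variable {G : Type} [LieRing G] [LieAlgebra k G]

/-- sign -/
def eps (k : Type) [Field k] (p : ℤ) : k := (-1 : k) ^ p

lemma eps_add (p q : ℤ) : eps k (p + q) = eps k p * eps k q :=
  zpow_add₀ (by simp) p q

lemma eps_sq (p : ℤ) : eps k p * eps k p = 1 := by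
  unfold eps
  rw [← mul_zpow]; simp

lemma eps_neg (p : ℤ) : eps k (-p) = eps k p := by
  unfold eps
  rw [zpow_neg, ← inv_zpow]; norm_num

lemma eps_sub (p q : ℤ) : eps k (p - q) = eps k p * eps k q := by
  rw [sub_eq_add_neg, eps_add, eps_neg]

lemma eps_one : eps k 1 = -1 := by simp [eps]

lemma eps_zero : eps k 0 = 1 := by simp [eps]

lemma eps_nat (n : ℕ) : eps k (n : ℤ) = (-1) ^ n := by simp [eps]

lemma eps_sub_one (p : ℤ) : eps k (p - 1) = - eps k p := by
  rw [eps_sub, eps_one]; ring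

/-- the Lie bracket as a bilinear map -/
def lieB : G →ₗ[k] G →ₗ[k] G :=
  LinearMap.mk₂ k (fun a b => ⁅a, b⁆) add_lie (fun c a b => smul_lie c a b) lie_add
    (fun c a b => lie_smul c a b)

lemma lieB_apply (a b : G) : lieB (k := k) a b = ⁅a, b⁆ := rfl

/-- recursive shuffle -/
noncomputable def shn (s : ℕ → G →ₗ⁅k⁆ G) : ℕ → ℕ → ℤ → ℤ → (G →ₗ[k] G →ₗ[k] G)
  | 0, _, p, q => if p = 0 ∧ q = 0 then lieB else 0
  | n + 1, j, p, q =>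
      eps k p • ((shn s n (j + 1) p (q - 1)).comp (s j).toLinearMap) +
        (shn s n (j + 1) (p - 1) q).compl₂ (s j).toLinearMap

/-- shuffle bracket on the total object -/
noncomputable def shz (s : ℕ → G →ₗ⁅k⁆ G) (j : ℕ) (p q : ℤ) : G →ₗ[k] G →ₗ[k] G :=
  shn s (p + q).toNat j p q

lemma shn_neg (s : ℕ → G →ₗ⁅k⁆ G) (n : ℕ) : ∀ (j : ℕ) (p q : ℤ), (p < 0 ∨ q < 0 ∨ p + q ≠ n) →
    shn s n j p q = 0 := by
  induction n with
  | zero => 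
    intro j p q h
    rw [shn, if_neg]
    push_cast at h
    omega
  | succ n ih =>
    intro j p q h
    push_cast at h
    rw [shn, ih, ih]
    · ext; simp
    · omega
    · omega

lemma shz_neg (s : ℕ → G →ₗ⁅k⁆ G) (j : ℕ) (p q : ℤ) (h : p < 0 ∨ q < 0) : shz s j p q = 0 := by
  apply shn_neg; omega

lemma shz_zero (s : ℕ → G →ₗ⁅k⁆ G) (j : ℕ) (a b : G) : shz s j 0 0 a b = ⁅a, b⁆ := by
  simp [shz, shn, lieB_apply]

lemma shz_rec (s : ℕ → G →ₗ⁅k⁆ G) (j : ℕ) (p q : ℤ) (h : p ≠ 0 ∨ q ≠ 0) (a b : G) :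
    shz s j p q a b = eps k p • shz s (j + 1) p (q - 1) (s j a) b +
      shz s (j + 1) (p - 1) q a (s j b) := by
  by_cases h' : p < 0 ∨ q < 0
  · rw [shz_neg, shz_neg, shz_neg]
    · simp
    all_goals omega
  · obtain ⟨n, hn⟩ : ∃ n : ℕ, p + q = n + 1 := ⟨(p + q - 1).toNat, by omega⟩
    have e1 : (p + q).toNat = n + 1 := by omega
    have e2 : (p + (q - 1)).toNat = n := by omega
    have e3 : (p - 1 + q).toNat = n := by omega
    rw [shz, shz, shz, e1, e2, e3, shn]
    simp

variable (s : ℕ → G →ₗ⁅k⁆ G)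

lemma shz_antisymm (n : ℕ) : ∀ (j : ℕ) (p q : ℤ), (p + q).toNat = n → ∀ a b,
    shz s j p q a b = - (eps k (p * q) • shz s j q p b a) := by
  induction n with
  | zero =>
    intro j p q h a b
    by_cases h0 : p < 0 ∨ q < 0
    · rw [shz_neg, shz_neg] <;> first | omega | simp
    · obtain rfl : p = 0 := by omega
      obtain rfl : q = 0 := by omega
      simp [shz_zero, eps_zero]
  | succ n ih =>
    intro j p q h a b
    rw [shz_rec s j p q (by omega), shz_rec s j q p (by omega), ih (j + 1) p (q - 1) (by omega),
      ih (j + 1) (p - 1) q (by omega)]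
    rw [mul_sub, sub_mul, eps_sub, eps_sub, mul_one, one_mul]
    have := eps_sq (k := k) p
    have := eps_sq (k := k) q
    match_scalars <;> grind

section deg
variable (hs : ∀ i j, i ≤ j → ∀ x, s i (s j x) = s (j + 1) (s i x))
include hs

lemma s_shz (n : ℕ) : ∀ (i j : ℕ) (p q : ℤ), i ≤ j → (p + q).toNat = n → ∀ a b,
    s i (shz s j p q a b) = shz s (j + 1) p q (s i a) (s i b) := by
  induction n with
  | zero =>
    intro i j p q hi h a b
    by_cases h0 : p < 0 ∨ q < 0
    · rw [shz_neg, shz_neg] <;> first | omega | simp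
    · obtain rfl : p = 0 := by omega
      obtain rfl : q = 0 := by omega
      simp [shz_zero]
  | succ n ih =>
    intro i j p q hi h a b
    rw [shz_rec s j p q (by omega), shz_rec s (j + 1) p q (by omega)]
    rw [map_add, map_smul, ih i (j + 1) p (q - 1) (by omega) (by omega),
      ih i (j + 1) (p - 1) q (by omega) (by omega), hs i j hi, hs i j hi]

lemma shz3_rec (j : ℕ) (p q r : ℤ) (hp : 0 ≤ p) (hq : 0 ≤ q) (hr : 0 ≤ r)
    (h : p + q + r ≠ 0) (a b c : G) :
    shz s j p (q + r) a (shz s j q r b c) =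
      (eps k p * eps k q) • shz s (j + 1) p (q + (r - 1)) (s j a) (shz s (j + 1) q (r - 1) (s j b) c)
      + eps k p • shz s (j + 1) p (q - 1 + r) (s j a) (shz s (j + 1) (q - 1) r b (s j c))
      + shz s (j + 1) (p - 1) (q + r) a (shz s (j + 1) q r (s j b) (s j c)) := by
  rw [shz_rec s j p (q + r) (by omega), s_shz s hs _ j j q r le_rfl rfl]
  by_cases h0 : q = 0 ∧ r = 0
  · obtain ⟨rfl, rfl⟩ := h0
    rw [shz_neg s (j + 1) p (0 + 0 - 1) (by omega), shz_neg s (j + 1) p (0 + (0 - 1)) (by omega),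
      shz_neg s (j + 1) p (0 - 1 + 0) (by omega)]
    simp
  · rw [shz_rec s j q r (by omega) b c]
    rw [map_add, map_smul, show q + (r - 1) = q + r - 1 by ring,
      show q - 1 + r = q + r - 1 by ring]
    module

lemma shz_jacobi (n : ℕ) : ∀ (j : ℕ) (p q r : ℤ), (p + q + r).toNat = n → ∀ a b c,
    eps k (r * p) • shz s j p (q + r) a (shz s j q r b c) +
    eps k (p * q) • shz s j q (r + p) b (shz s j r p c a) +
    eps k (q * r) • shz s j r (p + q) c (shz s j p q a b) = 0 := by
  induction n with
  | zero =>
    intro j p q r h a b c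
    by_cases h0 : p < 0 ∨ q < 0 ∨ r < 0
    · rcases h0 with h0 | h0 | h0
      · rw [shz_neg s j p _ (by omega), shz_neg s j r p (by omega), shz_neg s j p q (by omega)]
        simp
      · rw [shz_neg s j q r (by omega), shz_neg s j q _ (by omega), shz_neg s j p q (by omega)]
        simp
      · rw [shz_neg s j q r (by omega), shz_neg s j r p (by omega), shz_neg s j r _ (by omega)]
        simp
    · obtain rfl : p = 0 := by omega
      obtain rfl : q = 0 := by omega
      obtain rfl : r = 0 := by omega
      simp only [add_zero, shz_zero, mul_zero, eps_zero, one_smul]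
      exact lie_jacobi a b c
  | succ n ih =>
    intro j p q r h a b c
    by_cases h0 : p < 0 ∨ q < 0 ∨ r < 0
    · rcases h0 with h0 | h0 | h0
      · rw [shz_neg s j p _ (by omega), shz_neg s j r p (by omega), shz_neg s j p q (by omega)]
        simp
      · rw [shz_neg s j q r (by omega), shz_neg s j q _ (by omega), shz_neg s j p q (by omega)]
        simp
      · rw [shz_neg s j q r (by omega), shz_neg s j r p (by omega), shz_neg s j r _ (by omega)]
        simp
    rw [shz3_rec s hs j p q r (by omega) (by omega) (by omega) (by omega),
      shz3_rec s hs j q r p (by omega) (by omega) (by omega) (by omega),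
      shz3_rec s hs j r p q (by omega) (by omega) (by omega) (by omega)]
    have i1 := ih (j + 1) (p - 1) q r (by omega) a (s j b) (s j c)
    have i2 := ih (j + 1) p (q - 1) r (by omega) (s j a) b (s j c)
    have i3 := ih (j + 1) p q (r - 1) (by omega) (s j a) (s j b) c
    simp only [mul_sub, sub_mul, eps_sub, mul_one, one_mul] at i1 i2 i3
    have hp := eps_sq (k := k) p
    have hq := eps_sq (k := k) q
    have hr := eps_sq (k := k) r
    have key := congrArg₂ (· + ·) (congrArg (eps k r • ·) i1)
      (congrArg₂ (· + ·) (congrArg (eps k p • ·) i2) (congrArg (eps k q • ·) i3))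
    simp only [smul_zero, add_zero] at key
    rw [← key]
    match_scalars <;> grind

lemma shz_deg (n : ℕ) : ∀ (j i : ℕ) (p q : ℤ), (p + q).toNat = n → (i : ℤ) < p → ∀ a b,
    shz s j p q (s (j + i) a) b ∈ ⨆ m, LinearMap.range (s m).toLinearMap := by
  induction n with
  | zero =>
    intro j i p q h hi a b
    rw [shz_neg s j p q (by omega)]
    simp
  | succ n ih =>
    intro j i p q h hi a b
    rw [shz_rec s j p q (by omega)]
    refine add_mem (Submodule.smul_mem _ _ ?_) ?_
    · rw [hs j (j + i) (by omega), show j + i + 1 = j + 1 + i by ring]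
      exact ih (j + 1) i p (q - 1) (by omega) hi _ _
    · cases i with
      | zero =>
        rw [add_zero, ← s_shz s hs _ j j (p - 1) q le_rfl rfl]
        exact Submodule.mem_iSup_of_mem j ⟨_, rfl⟩
      | succ i =>
        rw [show j + (i + 1) = j + 1 + i by ring]
        exact ih (j + 1) i (p - 1) q (by omega) (by push_cast at hi; omega) _ _

end deg

section der
variable (d : ℕ → G →ₗ⁅k⁆ G)

/-- partial differential -/
noncomputable def dd (j : ℕ) (p : ℤ) : G →ₗ[k] G :=
  ∑ i ∈ range (p + 1).toNat, (-1 : k) ^ i • (d (j + i)).toLinearMap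

lemma dd_apply (j : ℕ) (p : ℤ) (x : G) :
    dd d j p x = ∑ i ∈ range (p + 1).toNat, (-1 : k) ^ i • d (j + i) x := by
  simp [dd, LinearMap.sum_apply]

lemma dd_rec (j : ℕ) (p : ℤ) (hp : 0 ≤ p) (x : G) :
    dd d j p x = d j x - dd d (j + 1) (p - 1) x := by
  obtain ⟨n, rfl⟩ := Int.eq_ofNat_of_zero_le hp
  rw [dd_apply, dd_apply]
  rw [show ((n : ℤ) + 1).toNat = n + 1 by omega, show ((n : ℤ) - 1 + 1).toNat = n by omega,
    sum_range_succ']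
  simp only [pow_succ, pow_zero, add_zero, one_smul]
  rw [add_comm, sub_eq_add_neg, ← sum_neg_distrib]
  congr 1
  apply sum_congr rfl
  intro i _
  rw [show j + (i + 1) = j + 1 + i by ring]
  simp

variable (hle : ∀ i j, i ≤ j → ∀ x, d i (s (j + 1) x) = s j (d i x))
  (hgt : ∀ i j, j < i → ∀ x, d (i + 1) (s j x) = s j (d i x))

include hgt in
lemma dd_s (j : ℕ) (p : ℤ) (hp : 0 ≤ p) (x : G) (hx : d (j + 1) (s j x) = x) :
    dd d (j + 1) p (s j x) = x - s j (dd d (j + 1) (p - 1) x) := by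
  rw [dd_rec d _ _ hp, hx]
  congr 1
  rw [dd_apply, dd_apply, map_sum]
  apply sum_congr rfl
  intro i _
  rw [map_smul, show j + 1 + 1 + i = j + 1 + i + 1 by ring, hgt _ _ (by omega)]

include hle in
lemma d_shz (n : ℕ) : ∀ (i j : ℕ) (p q : ℤ), i ≤ j → (p + q).toNat = n → ∀ a b,
    d i (shz s (j + 1) p q a b) = shz s j p q (d i a) (d i b) := by
  induction n with
  | zero =>
    intro i j p q hi h a b
    by_cases h0 : p < 0 ∨ q < 0
    · rw [shz_neg, shz_neg] <;> first | omega | simp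
    · obtain rfl : p = 0 := by omega
      obtain rfl : q = 0 := by omega
      simp [shz_zero]
  | succ n ih =>
    intro i j p q hi h a b
    rw [shz_rec s j p q (by omega), shz_rec s (j + 1) p q (by omega)]
    rw [map_add, map_smul, ih i (j + 1) p (q - 1) (by omega) (by omega),
      ih i (j + 1) (p - 1) q (by omega) (by omega), hle i j hi, hle i j hi]

variable (V : ℤ → G → Prop)
  (hV0 : ∀ (j : ℕ) (m : ℤ) x, j ≤ m → V m x → d j (s j x) = x)
  (hV1 : ∀ (j : ℕ) (m : ℤ) x, j ≤ m → V m x → d (j + 1) (s j x) = x)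
  (hVs : ∀ (j : ℕ) (m : ℤ) x, V m x → V (m + 1) (s j x))

include hle hgt hV0 hV1 hVs in
lemma shz_der (n : ℕ) : ∀ (j : ℕ) (p q : ℤ), p + q = n + 1 → ∀ a b, V (p + j) a → V (q + j) b →
    dd d j (p + q) (shz s j p q a b) =
      shz s j (p - 1) q (dd d j p a) b + eps k p • shz s j p (q - 1) a (dd d j q b) := by
  induction n with
  | zero =>
    intro j p q h a b ha hb
    push_cast at h
    by_cases h0 : p < 0 ∨ q < 0
    · rw [shz_neg, shz_neg, shz_neg] <;> first | omega | simp
    rw [dd_rec d j (p + q) (by omega), dd_rec d (j + 1) _ (by omega)]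
    have h1 : p + q - 1 - 1 = -1 := by omega
    rw [h1, shz_rec s j p q (by omega)]
    have h2 : ∀ i x, dd d i (-1) x = 0 := by intro i x; simp [dd_apply]
    rw [h2]
    have : (p = 0 ∧ q = 1) ∨ (p = 1 ∧ q = 0) := by omega
    rcases this with ⟨rfl, rfl⟩ | ⟨rfl, rfl⟩
    · rw [shz_neg s _ (0 - 1) _ (by omega), shz_neg s _ (0 - 1) _ (by omega)]
      rw [dd_rec d j 1 (by omega), dd_rec d _ (1 - 1) (by omega), show (1 - 1 - 1 : ℤ) = -1 by rfl,
        h2]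
      simp only [sub_self, shz_zero, eps_zero, one_smul, LinearMap.zero_apply, add_zero, zero_add,
        sub_zero]
      rw [LieHom.map_lie, LieHom.map_lie, hV0 j _ a (by omega) ha, hV1 j _ a (by omega) ha, lie_sub]
    · rw [shz_neg s _ _ (0 - 1) (by omega), shz_neg s _ _ (0 - 1) (by omega)]
      rw [dd_rec d j 1 (by omega), dd_rec d _ (1 - 1) (by omega), show (1 - 1 - 1 : ℤ) = -1 by rfl,
        h2]
      simp only [sub_self, shz_zero, smul_zero, LinearMap.zero_apply, add_zero, zero_add,
        sub_zero]
      rw [LieHom.map_lie, LieHom.map_lie, hV0 j _ b (by omega) hb, hV1 j _ b (by omega) hb, sub_lie]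
  | succ n ih =>
    intro j p q h a b ha hb
    push_cast at h
    by_cases h0 : p < 0 ∨ q < 0
    · rw [shz_neg, shz_neg, shz_neg] <;> first | omega | simp
    have a0 := hV0 j _ a (by omega) ha
    have b0 := hV0 j _ b (by omega) hb
    have a1 := hV1 j _ a (by omega) ha
    have b1 := hV1 j _ b (by omega) hb
    have i1 := ih (j + 1) p (q - 1) (by omega) (s j a) b
      (by convert hVs j _ a ha using 1; push_cast; ring)
      (by convert hb using 1; push_cast; ring)
    have i2 := ih (j + 1) (p - 1) q (by omega) a (s j b)
      (by convert ha using 1; push_cast; ring)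
      (by convert hVs j _ b hb using 1; push_cast; ring)
    rw [dd_s s d hgt j p (by omega) a a1] at i1
    rw [dd_s s d hgt j q (by omega) b b1] at i2
    rw [show p + (q - 1) = p + q - 1 by ring] at i1
    rw [show p - 1 + q = p + q - 1 by ring] at i2
    rw [dd_rec d j (p + q) (by omega), shz_rec s j p q (by omega), map_add, map_add, map_smul,
      map_smul, i1, i2, d_shz s d hle _ j j p (q - 1) le_rfl rfl,
      d_shz s d hle _ j j (p - 1) q le_rfl rfl, a0, b0, dd_rec d j p (by omega),
      dd_rec d j q (by omega)]
    simp only [map_sub, LinearMap.sub_apply]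
    rw [shz_rec s j (p - 1) q (by omega) (dd d (j + 1) (p - 1) a) b]
    rw [shz_rec s j p (q - 1) (by omega) a (dd d (j + 1) (q - 1) b)]
    rw [eps_sub_one]
    have hp := eps_sq (k := k) p
    match_scalars <;> grind

end der

end Gen

section Tot

variable {k : Type} [Field k]
variable {g : ℕ → Type} [∀ n, LieRing (g n)] [∀ n, LieAlgebra k (g n)]

instance totLieRing : LieRing (∀ n, g n) where
  bracket x y := fun n => ⁅x n, y n⁆
  add_lie x y z := by funext n; exact add_lie _ _ _
  lie_add x y z := by funext n; exact lie_add _ _ _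
  lie_self x := by funext n; exact lie_self _
  leibniz_lie x y z := by funext n; exact leibniz_lie _ _ _

lemma tot_lie_apply (x y : ∀ n, g n) (n : ℕ) : ⁅x, y⁆ n = ⁅x n, y n⁆ := rfl

instance totLieAlgebra : LieAlgebra k (∀ n, g n) where
  lie_smul c x y := by funext n; exact lie_smul _ _ _

/-- underlying function of the total degeneracy -/
def totSfun (σop : ∀ n, ℕ → g n →ₗ⁅k⁆ g (n + 1)) (i : ℕ) (x : ∀ n, g n) : ∀ n, g n
  | 0 => 0
  | n + 1 => if i ≤ n then σop n i (x n) else 0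

/-- total degeneracy -/
def totS (σop : ∀ n, ℕ → g n →ₗ⁅k⁆ g (n + 1)) (i : ℕ) : (∀ n, g n) →ₗ⁅k⁆ (∀ n, g n) where
  toFun := totSfun σop i
  map_add' x y := by
    funext n
    cases n with
    | zero => simp [totSfun]
    | succ n => by_cases h : i ≤ n <;> simp [totSfun, h]
  map_smul' c x := by
    funext n
    cases n with
    | zero => simp [totSfun]
    | succ n => by_cases h : i ≤ n <;> simp [totSfun, h]
  map_lie' {x y} := by
    funext n
    cases n with
    | zero => simp [totSfun, tot_lie_apply]
    | succ n => by_cases h : i ≤ n <;> simp [totSfun, h, tot_lie_apply]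

/-- total face -/
def totD (δop : ∀ n, ℕ → g (n + 1) →ₗ⁅k⁆ g n) (i : ℕ) : (∀ n, g n) →ₗ⁅k⁆ (∀ n, g n) where
  toFun x := fun n => if i ≤ n + 1 then δop n i (x (n + 1)) else 0
  map_add' x y := by
    funext n
    by_cases h : i ≤ n + 1 <;> simp [h]
  map_smul' c x := by
    funext n
    by_cases h : i ≤ n + 1 <;> simp [h]
  map_lie' {x y} := by
    funext n
    by_cases h : i ≤ n + 1 <;> simp [h, tot_lie_apply]

variable (σop : ∀ n, ℕ → g n →ₗ⁅k⁆ g (n + 1)) (δop : ∀ n, ℕ → g (n + 1) →ₗ⁅k⁆ g n)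

lemma totS_zero (i : ℕ) (x : ∀ n, g n) : totS σop i x 0 = 0 := rfl

lemma totS_succ (i : ℕ) (x : ∀ n, g n) (n : ℕ) :
    totS σop i x (n + 1) = if i ≤ n then σop n i (x n) else 0 := rfl

lemma totD_apply (i : ℕ) (x : ∀ n, g n) (n : ℕ) :
    totD δop i x n = if i ≤ n + 1 then δop n i (x (n + 1)) else 0 := rfl

lemma totS_totS
    (hσσ : ∀ n i j, i ≤ j → j ≤ n → ∀ x : g n,
      σop (n + 1) i (σop n j x) = σop (n + 1) (j + 1) (σop n i x)) (i j : ℕ) (h : i ≤ j)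
    (x : ∀ n, g n) : totS σop i (totS σop j x) = totS σop (j + 1) (totS σop i x) := by
  funext n
  match n with
  | 0 => simp [totS_zero]
  | 1 => simp [totS_succ, totS_zero]
  | n + 2 =>
    simp only [totS_succ]
    by_cases h1 : j ≤ n
    · rw [if_pos (by omega), if_pos h1, if_pos (by omega), if_pos (by omega), hσσ n i j h h1]
    · rw [if_neg h1, if_neg (by omega : ¬ (j + 1 ≤ n + 1))]
      simp

lemma totD_totS_le
    (hδσ_le : ∀ n i j, i ≤ j → j ≤ n → ∀ x : g (n + 1),
      δop (n + 1) i (σop (n + 1) (j + 1) x) = σop n j (δop n i x)) (i j : ℕ) (h : i ≤ j)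
    (x : ∀ n, g n) : totD δop i (totS σop (j + 1) x) = totS σop j (totD δop i x) := by
  funext n
  match n with
  | 0 => simp [totS_zero, totD_apply, totS_succ]
  | n + 1 =>
    simp only [totS_succ, totD_apply]
    by_cases h1 : j ≤ n
    · rw [if_pos (by omega), if_pos (by omega), if_pos (by omega), if_pos (by omega),
        hδσ_le n i j h h1]
    · rw [if_neg h1, if_neg (by omega : ¬ (j + 1 ≤ n + 1))]
      simp

lemma totD_totS_gt
    (hδσ_gt : ∀ n i j, j < i → i ≤ n + 1 → ∀ x : g (n + 1),
      δop (n + 1) (i + 1) (σop (n + 1) j x) = σop n j (δop n i x)) (i j : ℕ) (h : j < i)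
    (x : ∀ n, g n) : totD δop (i + 1) (totS σop j x) = totS σop j (totD δop i x) := by
  funext n
  match n with
  | 0 =>
    rw [totD_apply, if_neg (by omega), totS_zero]
  | n + 1 =>
    simp only [totS_succ, totD_apply]
    by_cases h1 : i ≤ n + 1
    · rw [if_pos (by omega), if_pos (by omega), if_pos (by omega), if_pos (by omega),
        hδσ_gt n i j h h1]
    · rw [if_neg h1, if_neg (by omega : ¬ (i + 1 ≤ n + 1 + 1))]
      simp

/-- vanishing below a degree -/
def Vd (m : ℤ) (x : ∀ n, g n) : Prop := x 0 = 0 ∧ ∀ n : ℕ, (n : ℤ) < m → x n = 0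

lemma Vd_s (j : ℕ) (m : ℤ) (x : ∀ n, g n) (h : Vd m x) : Vd (m + 1) (totS σop j x) := by
  refine ⟨rfl, fun n hn => ?_⟩
  match n with
  | 0 => rfl
  | n + 1 =>
    rw [totS_succ, h.2 n (by push_cast at hn; omega)]
    simp

lemma Vd_0 (hδσ_eq : ∀ n i (x : g (n + 1)), δop (n + 1) i (σop (n + 1) i x) = x ∧
      δop (n + 1) (i + 1) (σop (n + 1) i x) = x)
    (j : ℕ) (m : ℤ) (x : ∀ n, g n) (hj : j ≤ m) (h : Vd m x) :
    totD δop j (totS σop j x) = x := by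
  funext n
  match n with
  | 0 => rw [totD_apply, totS_succ, h.1]; simp
  | n + 1 =>
    rw [totD_apply, totS_succ]
    by_cases h1 : j ≤ n + 1
    · rw [if_pos h1, if_pos (by omega), (hδσ_eq _ _ _).1]
    · rw [if_neg h1, h.2 (n + 1) (by push_cast; omega)]
      simp

lemma Vd_1 (hδσ_eq : ∀ n i (x : g (n + 1)), δop (n + 1) i (σop (n + 1) i x) = x ∧
      δop (n + 1) (i + 1) (σop (n + 1) i x) = x)
    (j : ℕ) (m : ℤ) (x : ∀ n, g n) (hj : j ≤ m) (h : Vd m x) :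
    totD δop (j + 1) (totS σop j x) = x := by
  funext n
  match n with
  | 0 => rw [totD_apply, totS_succ, h.1]; simp
  | n + 1 =>
    rw [totD_apply, totS_succ]
    by_cases h1 : j ≤ n + 1
    · rw [if_pos h1, if_pos (by omega), (hδσ_eq _ _ _).2]
    · rw [if_neg h1, h.2 (n + 1) (by push_cast; omega)]
      simp

/-- homogeneous of degree m -/
def Hom (m : ℤ) (x : ∀ n, g n) : Prop := ∀ n : ℕ, (n : ℤ) ≠ m → x n = 0

lemma Hom_s (j : ℕ) (m : ℤ) (x : ∀ n, g n) (h : Hom m x) : Hom (m + 1) (totS σop j x) := by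
  intro n hn
  match n with
  | 0 => rfl
  | n + 1 =>
    rw [totS_succ, h n (by push_cast at hn; omega)]
    simp

lemma Hom_shz (n : ℕ) : ∀ (j : ℕ) (p q : ℤ), (p + q).toNat = n → ∀ a b : ∀ n, g n,
    Hom (p + j) a → Hom (q + j) b → Hom (p + q + j) (shz (totS σop) j p q a b) := by
  induction n with
  | zero =>
    intro j p q h a b ha hb
    by_cases h0 : p < 0 ∨ q < 0
    · rw [shz_neg _ _ _ _ h0]
      intro n _
      rfl
    · obtain rfl : p = 0 := by omega
      obtain rfl : q = 0 := by omega
      intro n hn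
      rw [shz_zero, tot_lie_apply, ha n (by omega)]
      simp
  | succ n ih =>
    intro j p q h a b ha hb m hm
    rw [shz_rec _ j p q (by omega)]
    rw [Pi.add_apply, Pi.smul_apply,
      ih (j + 1) p (q - 1) (by omega) (totS σop j a) b
        (by convert Hom_s σop j _ a ha using 1; push_cast; ring)
        (by convert hb using 1; push_cast; ring) m (by push_cast; omega),
      ih (j + 1) (p - 1) q (by omega) a (totS σop j b)
        (by convert ha using 1; push_cast; ring)
        (by convert Hom_s σop j _ b hb using 1; push_cast; ring) m (by push_cast; omega)]
    simp

lemma Hom_single (m : ℕ) (x : g m) : Hom (m : ℤ) (Pi.single m x : ∀ n, g n) := by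
  intro n hn
  exact Pi.single_eq_of_ne (by omega) x

lemma single_of_Hom (m : ℕ) (x : ∀ n, g n) (h : Hom (m : ℤ) x) : Pi.single m (x m) = x := by
  funext n
  by_cases hn : n = m
  · subst hn; simp
  · rw [Pi.single_eq_of_ne hn, h n (by omega)]

lemma Vd_of_Hom (m : ℕ) (x : ∀ n, g n) (h : Hom ((m : ℤ) + 1) x) : Vd ((m : ℤ) + 1) x :=
  ⟨h 0 (by push_cast; omega), fun n hn => h n (by omega)⟩

lemma totS_single (i m : ℕ) (h : i ≤ m) (x : g m) :
    totS σop i (Pi.single m x) = Pi.single (m + 1) (σop m i x) := by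
  funext n
  match n with
  | 0 => rw [totS_zero, Pi.single_eq_of_ne (by omega)]
  | n + 1 =>
    rw [totS_succ]
    by_cases hn : n = m
    · subst hn; simp [h]
    · rw [Pi.single_eq_of_ne hn, Pi.single_eq_of_ne (by omega)]; simp

lemma totD_single (i m : ℕ) (h : i ≤ m + 1) (x : g (m + 1)) :
    totD δop i (Pi.single (m + 1) x) = Pi.single m (δop m i x) := by
  funext n
  rw [totD_apply]
  by_cases hn : n = m
  · subst hn; simp [h]
  · rw [Pi.single_eq_of_ne (by omega), Pi.single_eq_of_ne hn]; simp

lemma dd_single (m : ℕ) (x : g (m + 1)) :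
    dd (totD δop) 0 ((m : ℤ) + 1) (Pi.single (m + 1) x) =
      Pi.single m (∑ i ∈ range (m + 2), (-1 : k) ^ i • δop m i x) := by
  rw [dd_apply, show ((m : ℤ) + 1 + 1).toNat = m + 2 by omega]
  have : ∀ i ∈ range (m + 2), (-1 : k) ^ i • (totD δop (0 + i)) (Pi.single (m + 1) x) =
      LinearMap.single k g m ((-1 : k) ^ i • δop m i x) := by
    intro i hi
    rw [zero_add, totD_single δop i m (by rw [mem_range] at hi; omega), map_smul]
    rfl
  rw [sum_congr rfl this, ← map_sum]
  rfl

lemma mem_deg (z : ∀ n, g n)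
    (hz : z ∈ ⨆ m, LinearMap.range (totS σop m).toLinearMap) (n : ℕ) :
    z n ∈ degenerateSubspace (k := k) σop n := by
  have : (⨆ m, LinearMap.range (totS σop m).toLinearMap) ≤
      (degenerateSubspace (k := k) σop n).comap (LinearMap.proj n) := by
    refine iSup_le fun i => ?_
    rintro _ ⟨x, rfl⟩
    rw [Submodule.mem_comap]
    change totS σop i x n ∈ _
    match n with
    | 0 => rw [totS_zero]; exact zero_mem _
    | n + 1 =>
      rw [totS_succ]
      split_ifs with h
      · exact Submodule.mem_iSup_of_mem (⟨i, by omega⟩ : Fin (n + 1)) ⟨_, rfl⟩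
      · exact zero_mem _
  exact this hz

/-- list of degeneracies -/
def opL (s : ℕ → (∀ n, g n) →ₗ⁅k⁆ (∀ n, g n)) : List ℕ → (∀ n, g n) → (∀ n, g n)
  | [], x => x
  | i :: l, x => opL s l (s i x)

lemma cast_apply (z : ∀ n, g n) {m n : ℕ} (h : m = n) (h' : g m = g n) :
    cast h' (z m) = z n := by
  subst h; rfl

lemma sorted_bound (i : ℕ) (l : List ℕ) (M : ℕ) (hl : (i :: l).Pairwise (· < ·))
    (hM : ∀ x ∈ i :: l, x < M) : i + (i :: l).length ≤ M := by
  induction l generalizing i with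
  | nil => have := hM i (by simp); simp; omega
  | cons a l ih =>
    have h1 := ih a (List.pairwise_cons.1 hl).2 (fun x hx => hM x (List.mem_cons_of_mem _ hx))
    have h2 := (List.pairwise_cons.1 hl).1 a (by simp)
    simp only [List.length_cons] at h1 ⊢
    omega

lemma iterDeg_eq (l : List ℕ) : ∀ (m : ℕ) (x : g m), l.Pairwise (· < ·) →
    (∀ y ∈ l, y < m + l.length) →
    iterDeg σop l m x = opL (totS σop) l (Pi.single m x) (m + l.length) := by
  induction l with
  | nil => intro m x _ _; simp [iterDeg, opL]
  | cons i l ih =>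
    intro m x hl hb
    have h0 := sorted_bound i l _ hl hb
    rw [List.length_cons] at h0
    rw [iterDeg, ih (m + 1) _ (List.pairwise_cons.1 hl).2
      (fun y hy => by
        have := hb y (List.mem_cons_of_mem _ hy)
        rw [List.length_cons] at this
        omega), opL, totS_single σop i m (by omega)]
    apply cast_apply
    rw [List.length_cons]; omega

lemma iterDegTo_eq (l : List ℕ) (m M : ℕ) (h : m + l.length = M) (x : g m)
    (hl : l.Pairwise (· < ·)) (hb : ∀ y ∈ l, y < M) :
    iterDegTo σop l m M h x = opL (totS σop) l (Pi.single m x) M := by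
  rw [iterDegTo, iterDeg_eq σop l m x hl (by rw [h]; exact hb)]
  exact cast_apply _ h _

/-- one term of the shuffle sum -/
noncomputable def shTerm (n j : ℕ) (p q : ℤ) (a b : ∀ n, g n) (S : Finset (Fin n)) : ∀ n, g n :=
  if (S.card : ℤ) = q then
    eps k ((∑ x ∈ S, (x : ℕ) : ℕ) + p * q + (S.card * (S.card - 1) / 2 : ℕ)) •
      ⁅opL (totS σop) ((S.sort (· ≤ ·)).map (fun x => x.val + j)) a,
        opL (totS σop) ((Sᶜ.sort (· ≤ ·)).map (fun x => x.val + j)) b⁆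
  else 0

lemma sum_finset_fin_succ {M : Type} [AddCommMonoid M] (n : ℕ) (F : Finset (Fin (n + 1)) → M) :
    ∑ S, F S = ∑ S : Finset (Fin n), F (insert 0 (S.map (Fin.succEmb n))) +
      ∑ S : Finset (Fin n), F (S.map (Fin.succEmb n)) := by
  have h1 : (univ : Finset (Finset (Fin (n + 1)))) =
      (insert 0 ((univ : Finset (Fin n)).map (Fin.succEmb n))).powerset := by
    rw [← powerset_univ]
    congr 1
    ext x
    refine Fin.cases ?_ (fun i => ?_) x <;> simp
  have h2 : ∀ F' : Finset (Fin (n + 1)) → M,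
      ∑ t ∈ ((univ : Finset (Fin n)).map (Fin.succEmb n)).powerset, F' t =
        ∑ S : Finset (Fin n), F' (S.map (Fin.succEmb n)) := by
    intro F'
    symm
    refine sum_bij (fun S _ => S.map (Fin.succEmb n)) ?_ ?_ ?_ ?_
    · intro S _
      rw [mem_powerset]
      exact map_subset_map.2 (subset_univ _)
    · intro S _ T _ h
      exact map_injective _ h
    · intro T hT
      rw [mem_powerset, subset_map_iff] at hT
      obtain ⟨u, _, rfl⟩ := hT
      exact ⟨u, mem_univ _, rfl⟩
    · intros; rfl
  rw [h1, sum_powerset_insert (by simp [Fin.succ_ne_zero]), h2, h2, add_comm]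

lemma sort_succ (n j : ℕ) (S : Finset (Fin n)) :
    ((S.map (Fin.succEmb n)).sort (· ≤ ·)).map (fun x => x.val + j) =
      (S.sort (· ≤ ·)).map (fun x => x.val + (j + 1)) := by
  rw [← Finset.map_sort (r := (· ≤ ·)) (s := S) (f := Fin.succEmb n) (r' := (· ≤ ·))]
  · rw [List.map_map]
    apply List.map_congr_left
    intro x _
    simp; omega
  · intro a _ b _
    simp

lemma sort_insert_succ (n j : ℕ) (S : Finset (Fin n)) :
    ((insert 0 (S.map (Fin.succEmb n))).sort (· ≤ ·)).map (fun x => x.val + j) =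
      j :: (S.sort (· ≤ ·)).map (fun x => x.val + (j + 1)) := by
  rw [Finset.sort_insert, List.map_cons, sort_succ]
  · simp
  · intro b _; exact Fin.zero_le b
  · simp [Fin.succ_ne_zero]

lemma compl_succ (n : ℕ) (S : Finset (Fin n)) :
    (S.map (Fin.succEmb n))ᶜ = insert 0 (Sᶜ.map (Fin.succEmb n)) := by
  ext x
  refine Fin.cases ?_ (fun i => ?_) x <;> simp [Fin.succ_ne_zero]

lemma compl_insert_succ (n : ℕ) (S : Finset (Fin n)) :
    (insert 0 (S.map (Fin.succEmb n)))ᶜ = Sᶜ.map (Fin.succEmb n) := by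
  ext x
  refine Fin.cases ?_ (fun i => ?_) x <;> simp [Fin.succ_ne_zero]

lemma sum_succ_val (n : ℕ) (S : Finset (Fin n)) :
    ∑ x ∈ S.map (Fin.succEmb n), (x : ℕ) = ∑ x ∈ S, (x : ℕ) + S.card := by
  rw [sum_map]
  simp [sum_add_distrib]

lemma eps_congr (a b : ℤ) (h : ∃ c, a = b + 2 * c) : eps k a = eps k b := by
  obtain ⟨c, rfl⟩ := h
  rw [two_mul, eps_add, eps_add, eps_sq, mul_one]

lemma shTerm_insert (n j : ℕ) (p q : ℤ) (a b : ∀ n, g n) (S : Finset (Fin n)) :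
    shTerm σop (n + 1) j p q a b (insert 0 (S.map (Fin.succEmb n))) =
      eps k p • shTerm σop n (j + 1) p (q - 1) (totS σop j a) b S := by
  have hc : (insert 0 (S.map (Fin.succEmb n))).card = S.card + 1 := by
    rw [card_insert_of_notMem (by simp [Fin.succ_ne_zero]), card_map]
  unfold shTerm
  rw [hc]
  by_cases h : (S.card : ℤ) = q - 1
  · rw [if_pos h, if_pos (by push_cast; omega), smul_smul, ← eps_add, compl_insert_succ,
      sort_insert_succ, sort_succ, opL, sum_insert (by simp [Fin.succ_ne_zero]), sum_succ_val]
    congr 1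
    apply eps_congr
    refine ⟨S.card, ?_⟩
    have h1 : (S.card + 1) * (S.card + 1 - 1) / 2 = S.card * (S.card - 1) / 2 + S.card := by
      rw [← Nat.triangle_succ]
    rw [h1]
    obtain rfl : q = S.card + 1 := by omega
    push_cast
    simp
    ring
  · rw [if_neg h, if_neg (by push_cast; omega)]
    simp

lemma shTerm_succ (n j : ℕ) (p q : ℤ) (a b : ∀ n, g n) (S : Finset (Fin n)) :
    shTerm σop (n + 1) j p q a b (S.map (Fin.succEmb n)) =
      shTerm σop n (j + 1) (p - 1) q a (totS σop j b) S := by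
  unfold shTerm
  rw [card_map]
  by_cases h : (S.card : ℤ) = q
  · rw [if_pos h, if_pos h, compl_succ,
      sort_insert_succ, sort_succ, opL, sum_succ_val]
    congr 1
    apply eps_congr
    refine ⟨q, ?_⟩
    push_cast
    rw [h]
    ring
  · rw [if_neg h, if_neg h]

lemma sum_shTerm (n : ℕ) : ∀ (j : ℕ) (p q : ℤ) (a b : ∀ n, g n), p + q = n →
    ∑ S, shTerm σop n j p q a b S = shn (totS σop) n j p q a b := by
  induction n with
  | zero =>
    intro j p q a b h
    rw [Fintype.sum_unique, shn]
    have : (default : Finset (Fin 0)) = ∅ := Subsingleton.elim _ _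
    rw [this, shTerm]
    have e : (∅ : Finset (Fin 0))ᶜ = ∅ := Subsingleton.elim _ _
    rw [e]
    by_cases h0 : q = 0
    · subst h0
      obtain rfl : p = 0 := by push_cast at h; omega
      simp [opL, eps_zero, lieB_apply]
    · rw [if_neg (by simpa using Ne.symm h0), if_neg (by omega)]
      rfl
  | succ n ih =>
    intro j p q a b h
    push_cast at h
    rw [sum_finset_fin_succ, shn]
    simp only [shTerm_insert, shTerm_succ]
    rw [← smul_sum, ih _ _ _ _ _ (by omega), ih _ _ _ _ _ (by omega)]
    rfl

lemma shuffle_eq [CharZero k] (p q : ℕ) (a : g p) (b : g q) :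
    shuffleBracket (k := k) σop p q a b =
      shz (totS σop) 0 p q (Pi.single p a) (Pi.single q b) (p + q) := by
  rw [shz, show ((p : ℤ) + q).toNat = p + q by omega, ← sum_shTerm σop (p + q) 0 p q _ _ (by simp)]
  rw [shuffleBracket, Finset.sum_apply]
  have h0 : ∀ S : Finset (Fin (p + q)), S.card ≠ q →
      shTerm σop (p + q) 0 p q (Pi.single p a) (Pi.single q b) S (p + q) = 0 := by
    intro S hS
    rw [shTerm, if_neg (by exact_mod_cast hS)]
    rfl
  have hsort : ∀ S : Finset (Fin (p + q)),
      ((S.sort (· ≤ ·)).map Fin.val).Pairwise (· < ·) ∧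
      ∀ y ∈ (S.sort (· ≤ ·)).map Fin.val, y < p + q := by
    intro S
    constructor
    · rw [List.pairwise_map]
      exact (Finset.sortedLT_sort S).pairwise
    · intro y hy
      obtain ⟨x, _, rfl⟩ := List.mem_map.1 hy
      exact x.2
  have h1 : ∀ S : {S : Finset (Fin (p + q)) // S.card = q}, 
    ((-1 : k) ^ ((∑ x ∈ S.1, (x : ℕ)) + p * q + q * (q - 1) / 2)) •
      ⁅iterDegTo σop ((S.1.sort (· ≤ ·)).map Fin.val) p (p + q)
          (by simp [Finset.length_sort, S.2]) a,
        iterDegTo σop (((S.1ᶜ).sort (· ≤ ·)).map Fin.val) q (p + q)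
          (by simp [Finset.length_sort, Finset.card_compl, S.2]; omega) b⁆ =
      shTerm σop (p + q) 0 p q (Pi.single p a) (Pi.single q b) S.1 (p + q) := by
    rintro ⟨S, hS⟩
    rw [iterDegTo_eq _ _ _ _ _ _ (hsort S).1 (hsort S).2,
      iterDegTo_eq _ _ _ _ _ _ (hsort Sᶜ).1 (hsort Sᶜ).2, shTerm,
      if_pos (by exact_mod_cast hS), ← eps_nat, hS]
    simp only [add_zero]
    rw [Pi.smul_apply, tot_lie_apply]
    push_cast
    rfl
  rw [sum_congr rfl (fun S _ => h1 S)]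
  rw [← Finset.sum_subtype (univ.filter fun S : Finset (Fin (p + q)) => S.card = q) (by simp)
    (fun S => shTerm σop (p + q) 0 p q (Pi.single p a) (Pi.single q b) S (p + q))]
  apply sum_filter_of_ne
  intro S _ hS
  by_contra hc
  exact hS (h0 S hc)

end Tot

section Fin

variable {k : Type} [Field k] [CharZero k]
variable {g : ℕ → Type} [∀ n, LieRing (g n)] [∀ n, LieAlgebra k (g n)]
variable (σop : ∀ n, ℕ → g n →ₗ⁅k⁆ g (n + 1)) (δop : ∀ n, ℕ → g (n + 1) →ₗ⁅k⁆ g n)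

lemma deg_left
    (hσσ : ∀ n i j, i ≤ j → j ≤ n → ∀ x : g n,
      σop (n + 1) i (σop n j x) = σop (n + 1) (j + 1) (σop n i x))
    (p q : ℕ) (a : g p) (b : g q) (ha : a ∈ degenerateSubspace (k := k) σop p) :
    shuffleBracket (k := k) σop p q a b ∈ degenerateSubspace (k := k) σop (p + q) := by
  have key : degenerateSubspace (k := k) σop p ≤
      (degenerateSubspace (k := k) σop (p + q)).comap
        ((LinearMap.proj (p + q)).comp
          (((shz (totS σop) 0 p q).flip (Pi.single q b)).comp (LinearMap.single k g p))) := by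
    match p with
    | 0 => exact bot_le
    | p + 1 =>
      refine iSup_le fun i => ?_
      rintro _ ⟨x, rfl⟩
      rw [Submodule.mem_comap]
      change shz (totS σop) 0 ((p + 1 : ℕ) : ℤ) q (Pi.single (p + 1) (σop p i x)) (Pi.single q b)
        (p + 1 + q) ∈ _
      apply mem_deg
      rw [← totS_single σop i p (by omega)]
      have := shz_deg (totS σop) (totS_totS σop hσσ) _ 0 i ((p + 1 : ℕ) : ℤ) q rfl
        (by exact_mod_cast i.2) (Pi.single p x) (Pi.single q b)
      rwa [zero_add] at this
  rw [shuffle_eq]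
  exact key ha

lemma single_shuffle (p q : ℕ) (a : g p) (b : g q) :
    Pi.single (p + q) (shuffleBracket (k := k) σop p q a b) =
      shz (totS σop) 0 p q (Pi.single p a) (Pi.single q b) := by
  rw [shuffle_eq]
  apply single_of_Hom
  have := Hom_shz σop _ 0 (p : ℤ) q rfl (Pi.single p a) (Pi.single q b)
    (by simpa using Hom_single p a) (by simpa using Hom_single q b)
  simpa using this

lemma shuffle_antisymm (p q : ℕ) (a : g p) (b : g q) :
    shuffleBracket (k := k) σop p q a b = -(((-1 : k) ^ (p * q)) •
      (shz (totS σop) 0 q p (Pi.single q b) (Pi.single p a) (p + q))) := by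
  rw [shuffle_eq, shz_antisymm (totS σop) _ 0 p q rfl, ← eps_nat]
  push_cast
  rfl

lemma deg_cast (z : ∀ n, g n) {m n : ℕ} (h : m = n)
    (hz : z m ∈ degenerateSubspace (k := k) σop m) : z n ∈ degenerateSubspace (k := k) σop n := by
  subst h; exact hz

lemma deg_right
    (hσσ : ∀ n i j, i ≤ j → j ≤ n → ∀ x : g n,
      σop (n + 1) i (σop n j x) = σop (n + 1) (j + 1) (σop n i x))
    (p q : ℕ) (a : g p) (b : g q) (hb : b ∈ degenerateSubspace (k := k) σop q) :
    shuffleBracket (k := k) σop p q a b ∈ degenerateSubspace (k := k) σop (p + q) := by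
  rw [shuffle_antisymm]
  refine neg_mem (Submodule.smul_mem _ _ ?_)
  have := deg_left σop hσσ q p b a hb
  rw [shuffle_eq] at this
  exact deg_cast σop _ (Nat.add_comm q p) this

lemma diff_deg
    (hδδ : ∀ n i j, i ≤ j → j ≤ n + 1 → ∀ x : g (n + 2),
      δop n i (δop (n + 1) (j + 1) x) = δop n j (δop (n + 1) i x))
    (hσσ : ∀ n i j, i ≤ j → j ≤ n → ∀ x : g n,
      σop (n + 1) i (σop n j x) = σop (n + 1) (j + 1) (σop n i x))
    (hδσ_le : ∀ n i j, i ≤ j → j ≤ n → ∀ x : g (n + 1),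
      δop (n + 1) i (σop (n + 1) (j + 1) x) = σop n j (δop n i x))
    (hδσ_gt : ∀ n i j, j < i → i ≤ n + 1 → ∀ x : g (n + 1),
      δop (n + 1) (i + 1) (σop (n + 1) j x) = σop n j (δop n i x))
    (hδσ_eq : ∀ n i (x : g (n + 1)), δop (n + 1) i (σop (n + 1) i x) = x ∧
      δop (n + 1) (i + 1) (σop (n + 1) i x) = x)
    (n j : ℕ) (hj : j ≤ n) (x : g n) :
    ∑ i ∈ range (n + 2), (-1 : k) ^ i • δop n i (σop n j x) ∈
      degenerateSubspace (k := k) σop n := by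
  match n with
  | 0 =>
    obtain rfl : j = 0 := by omega
    have e := hδδ 0 0 1 (by omega) (by omega) (σop 1 0 (σop 0 0 x))
    rw [(hδσ_eq _ _ _).1, hσσ 0 0 0 le_rfl le_rfl, (hδσ_eq 0 1 _).2] at e
    rw [sum_range_succ, sum_range_one, e]
    simp
  | n + 1 =>
    have h1 : j ∈ range (n + 1 + 2) := by rw [mem_range]; omega
    have h2 : j + 1 ∈ (range (n + 1 + 2)).erase j := by
      rw [mem_erase, mem_range]; omega
    rw [← add_sum_erase _ _ h1, ← add_sum_erase _ _ h2, (hδσ_eq _ _ _).1, (hδσ_eq _ _ _).2,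
      ← add_assoc, pow_succ]
    rw [show (-1 : k) ^ j • x + ((-1 : k) ^ j * -1) • x = 0 by module, zero_add]
    refine sum_mem fun i hi => Submodule.smul_mem _ _ ?_
    rw [mem_erase, mem_erase, mem_range] at hi
    obtain ⟨hi1, hi2, hi3⟩ := hi
    by_cases hij : i < j
    · obtain ⟨j, rfl⟩ : ∃ j', j = j' + 1 := ⟨j - 1, by omega⟩
      rw [hδσ_le n i j (by omega) (by omega)]
      exact Submodule.mem_iSup_of_mem (⟨j, by omega⟩ : Fin (n + 1)) ⟨_, rfl⟩
    · obtain ⟨i, rfl⟩ : ∃ i', i = i' + 1 := ⟨i - 1, by omega⟩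
      rw [hδσ_gt n i j (by omega) (by omega)]
      exact Submodule.mem_iSup_of_mem (⟨j, by omega⟩ : Fin (n + 1)) ⟨_, rfl⟩

lemma cast_mk (z : ∀ n, g n) {m n : ℕ} (h : m = n)
    (h' : (g m ⧸ degenerateSubspace (k := k) σop m) = (g n ⧸ degenerateSubspace (k := k) σop n)) :
    cast h' (Submodule.Quotient.mk (z m)) = Submodule.Quotient.mk (z n) := by
  subst h; rfl

/-- shuffle bracket as bilinear map -/
noncomputable def shB (p q : ℕ) : g p →ₗ[k] g q →ₗ[k] g (p + q) :=
  (((shz (totS σop) 0 p q).comp (LinearMap.single k g p)).compl₂ (LinearMap.single k g q)).compr₂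
    (LinearMap.proj (p + q))

lemma shB_apply (p q : ℕ) (a : g p) (b : g q) :
    shB σop p q a b = shuffleBracket (k := k) σop p q a b := by
  rw [shuffle_eq]; rfl

end Fin

/-- Let `g` be a simplicial Lie algebra over a field of characteristic 0,
with face operators `δop` and degeneracy operators `σop` satisfying the simplicial
identities.  Then the degenerate subspace `D_n = Σ_i σ_i(g_{n−1}) ⊆ g_n` is a (two-sided)
ideal for the Eilenberg–Zilber shuffle bracket `⟦·,·⟧`; consequently the shuffle bracket
descends to the quotient complex `N(g)_n = g_n/D_n`, making it into a chain Lie algebra: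
the induced bracket `B` is graded antisymmetric, satisfies the graded Jacobi identity, and
the induced differential (the alternating sum of the faces) is a graded derivation for it. -/
theorem degenerate_subspace_is_shuffle_ideal
    (k : Type) [Field k] [CharZero k]
    (g : ℕ → Type) [∀ n, LieRing (g n)] [∀ n, LieAlgebra k (g n)]
    (δop : ∀ n, ℕ → g (n + 1) →ₗ⁅k⁆ g n)
    (σop : ∀ n, ℕ → g n →ₗ⁅k⁆ g (n + 1))
    -- the simplicial identities:
    (hδδ : ∀ n i j, i ≤ j → j ≤ n + 1 → ∀ x : g (n + 2),
      δop n i (δop (n + 1) (j + 1) x) = δop n j (δop (n + 1) i x))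
    (hσσ : ∀ n i j, i ≤ j → j ≤ n → ∀ x : g n,
      σop (n + 1) i (σop n j x) = σop (n + 1) (j + 1) (σop n i x))
    (hδσ_le : ∀ n i j, i ≤ j → j ≤ n → ∀ x : g (n + 1),
      δop (n + 1) i (σop (n + 1) (j + 1) x) = σop n j (δop n i x))
    (hδσ_gt : ∀ n i j, j < i → i ≤ n + 1 → ∀ x : g (n + 1),
      δop (n + 1) (i + 1) (σop (n + 1) j x) = σop n j (δop n i x))
    (hδσ_eq : ∀ n i (x : g (n + 1)), δop (n + 1) i (σop (n + 1) i x) = x ∧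
      δop (n + 1) (i + 1) (σop (n + 1) i x) = x) :
    letI D := degenerateSubspace (k := k) σop
    letI Q : ∀ n, Type := fun n => g n ⧸ D n
    -- (1) `D` is an ideal for the shuffle bracket:
    (∀ p q (a : g p) (b : g q), a ∈ D p →
        shuffleBracket (k := k) σop p q a b ∈ D (p + q)) ∧
    (∀ p q (a : g p) (b : g q), b ∈ D q →
        shuffleBracket (k := k) σop p q a b ∈ D (p + q)) ∧
    -- (2) the shuffle bracket descends to a chain Lie algebra structure on `N(g) = g/D`:
    ∃ B : ∀ p q, Q p →ₗ[k] Q q →ₗ[k] Q (p + q),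
      (∀ p q (a : g p) (b : g q),
        B p q (Submodule.Quotient.mk a) (Submodule.Quotient.mk b) =
          Submodule.Quotient.mk (shuffleBracket (k := k) σop p q a b)) ∧
      -- graded antisymmetry:
      (∀ p q (x : Q p) (y : Q q),
        B p q x y = -(((-1 : k) ^ (p * q)) •
          cast (congrArg Q (Nat.add_comm q p)) (B q p y x))) ∧
      -- graded Jacobi identity:
      (∀ p q r (x : Q p) (y : Q q) (z : Q r),
        ((-1 : k) ^ (r * p)) •
            cast (congrArg Q (by omega : p + (q + r) = p + q + r))
              (B p (q + r) x (B q r y z)) +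
          ((-1 : k) ^ (p * q)) •
            cast (congrArg Q (by omega : q + (r + p) = p + q + r))
              (B q (r + p) y (B r p z x)) +
          ((-1 : k) ^ (q * r)) •
            cast (congrArg Q (by omega : r + (p + q) = p + q + r))
              (B r (p + q) z (B p q x y)) = 0) ∧
      -- the differential (alternating sum of faces) descends and is a graded derivation:
      ∃ dB : ∀ n, Q (n + 1) →ₗ[k] Q n,
        (∀ n (a : g (n + 1)), dB n (Submodule.Quotient.mk a) =
          Submodule.Quotient.mk (∑ i ∈ Finset.range (n + 2), ((-1 : k) ^ i) • δop n i a)) ∧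
        (∀ p q (x : Q (p + 1)) (y : Q (q + 1)),
          dB (p + q + 1) (cast (congrArg Q (by omega : (p + 1) + (q + 1) = p + q + 1 + 1))
              (B (p + 1) (q + 1) x y)) =
            cast (congrArg Q (by omega : p + (q + 1) = p + q + 1))
                (B p (q + 1) (dB p x) y) +
              ((-1 : k) ^ (p + 1)) •
                cast (congrArg Q (by omega : (p + 1) + q = p + q + 1))
                  (B (p + 1) q x (dB q y))) := by
  let D := degenerateSubspace (k := k) σop
  let Q : ∀ n, Type := fun n => g n ⧸ D n
  have hL := deg_left σop hσσ
  have hR := deg_right σop hσσ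
  refine ⟨hL, hR, ?_⟩
  let B : ∀ p q, Q p →ₗ[k] Q q →ₗ[k] Q (p + q) := fun p q =>
    ((shB σop p q).compr₂ (D (p + q)).mkQ).liftQ₂ (D p) (D q)
      (by
        intro a ha
        rw [LinearMap.mem_ker]
        ext b
        change Submodule.Quotient.mk (shB σop p q a b) = 0
        rw [shB_apply, Submodule.Quotient.mk_eq_zero]
        exact hL p q a b ha)
      (by
        intro b hb
        rw [LinearMap.mem_ker]
        ext a
        change Submodule.Quotient.mk (shB σop p q a b) = 0
        rw [shB_apply, Submodule.Quotient.mk_eq_zero]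
        exact hR p q a b hb)
  have hB : ∀ p q (a : g p) (b : g q),
        B p q (Submodule.Quotient.mk a) (Submodule.Quotient.mk b) =
          Submodule.Quotient.mk (shuffleBracket (k := k) σop p q a b) := by
    intro p q a b
    rw [← shB_apply]
    rfl
  refine ⟨B, hB, ?_, ?_, ?_⟩
  · intro p q x y
    obtain ⟨a, rfl⟩ := Submodule.Quotient.mk_surjective _ x
    obtain ⟨b, rfl⟩ := Submodule.Quotient.mk_surjective _ y
    rw [hB, hB, shuffle_antisymm, shuffle_eq σop q p, cast_mk σop _ (Nat.add_comm q p)]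
    rfl
  · intro p q r x y z
    obtain ⟨a, rfl⟩ := Submodule.Quotient.mk_surjective _ x
    obtain ⟨b, rfl⟩ := Submodule.Quotient.mk_surjective _ y
    obtain ⟨c, rfl⟩ := Submodule.Quotient.mk_surjective _ z
    simp only [hB]
    rw [shuffle_eq σop p (q + r), shuffle_eq σop q (r + p), shuffle_eq σop r (p + q),
      cast_mk σop _ (by omega : p + (q + r) = p + q + r),
      cast_mk σop _ (by omega : q + (r + p) = p + q + r),
      cast_mk σop _ (by omega : r + (p + q) = p + q + r)]
    simp only [single_shuffle]
    have key := congrFun (shz_jacobi (totS σop) (totS_totS σop hσσ) _ 0 (p : ℤ) q r rfl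
      (Pi.single p a) (Pi.single q b) (Pi.single r c)) (p + q + r)
    have key2 := congrArg (Submodule.Quotient.mk (p := D (p + q + r))) key
    simp only [← eps_nat]
    push_cast
    exact key2
  · let dl : ∀ n, g (n + 1) →ₗ[k] g n := fun n =>
      ∑ i ∈ Finset.range (n + 2), ((-1 : k) ^ i) • (δop n i).toLinearMap
    have hdl : ∀ n a, dl n a = ∑ i ∈ Finset.range (n + 2), ((-1 : k) ^ i) • δop n i a := by
      intro n a
      simp [dl, LinearMap.sum_apply]
    have hdD : ∀ n, D (n + 1) ≤ (D n).comap (dl n) := by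
      intro n
      refine iSup_le fun i => ?_
      rintro _ ⟨x, rfl⟩
      rw [Submodule.mem_comap, hdl]
      exact diff_deg σop δop hδδ hσσ hδσ_le hδσ_gt hδσ_eq n i (by omega) x
    let dB : ∀ n, Q (n + 1) →ₗ[k] Q n := fun n => (D (n + 1)).mapQ (D n) (dl n) (hdD n)
    have hdB : ∀ n (a : g (n + 1)), dB n (Submodule.Quotient.mk a) =
          Submodule.Quotient.mk (dl n a) := fun n a => rfl
    have hdB' : ∀ n (a : g (n + 1)), dB n (Submodule.Quotient.mk a) =
          Submodule.Quotient.mk (∑ i ∈ Finset.range (n + 2), ((-1 : k) ^ i) • δop n i a) := by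
      intro n a
      rw [hdB, hdl]
    refine ⟨dB, hdB', ?_⟩
    intro p q x y
    obtain ⟨a, rfl⟩ := Submodule.Quotient.mk_surjective _ x
    obtain ⟨b, rfl⟩ := Submodule.Quotient.mk_surjective _ y
    have key := shz_der (totS σop) (totD δop) (totD_totS_le σop δop hδσ_le)
      (totD_totS_gt σop δop hδσ_gt) Vd (Vd_0 σop δop hδσ_eq) (Vd_1 σop δop hδσ_eq) (Vd_s σop)
      (p + q + 1) 0 ((p : ℤ) + 1) ((q : ℤ) + 1) (by push_cast; ring)
      (Pi.single (p + 1) a) (Pi.single (q + 1) b)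
      (by simpa using Vd_of_Hom p _ (by exact_mod_cast Hom_single (p + 1) a))
      (by simpa using Vd_of_Hom q _ (by exact_mod_cast Hom_single (q + 1) b))
    have hH := Hom_shz σop _ 0 ((p : ℤ) + 1) ((q : ℤ) + 1) rfl
      (Pi.single (p + 1) a) (Pi.single (q + 1) b)
      (by simpa using Hom_single (p + 1) a) (by simpa using Hom_single (q + 1) b)
    have hs := single_of_Hom (p + q + 1 + 1) _ (by convert hH using 1; push_cast; ring)
    rw [← hs] at key
    rw [show (p : ℤ) + 1 + (q + 1) = ((p + q + 1 : ℕ) : ℤ) + 1 by push_cast; ring,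
      dd_single, dd_single, dd_single] at key
    have key1 := congrArg (Submodule.Quotient.mk (p := D (p + q + 1)))
      (congrFun key (p + q + 1))
    rw [Pi.single_eq_same] at key1
    rw [hdB', hdB', hB, hB, hB, shuffle_eq, shuffle_eq, shuffle_eq,
      cast_mk σop _ (by omega : (p + 1) + (q + 1) = p + q + 1 + 1),
      cast_mk σop _ (by omega : p + (q + 1) = p + q + 1),
      cast_mk σop _ (by omega : (p + 1) + q = p + q + 1), hdB']
    simp only [← eps_nat] at key1 ⊢
    push_cast at key1 ⊢
    simp only [add_sub_cancel_right] at key1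
    exact key1
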